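/- Let n ≥ 2 and k = 2^n. For every ℓ ∈ {0,…,k−1}, the vertex v_ℓ lies in the projection of P^∅_n onto the coordinates (y_1, z_1); concretely, setting (y_1,z_1)^⊤ := v_ℓ and (y_{i+1},z_{i+1})^⊤ := R^{b^ℓ_i} R_i (y_i,z_i)^⊤ for i = 1,…,n yields a point (y,z) ∈ P^∅_n with (y_{n+1},z_{n+1})^⊤ = v_0. -/

import Mathlib

open Real MeasureTheory Matrix

/-- The clockwise rotation matrix by angle `π / 2 ^ j` (this is `R_{j+1}` in 1-based indexing). -/
noncomputable def rotM (j : ℕ) : Matrix (Fin 2) (Fin 2) ℝ :=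
  !![Real.cos (Real.pi / 2 ^ j), Real.sin (Real.pi / 2 ^ j);
     -Real.sin (Real.pi / 2 ^ j), Real.cos (Real.pi / 2 ^ j)]

/-- The reflection with respect to the first axis. -/
def reflM : Matrix (Fin 2) (Fin 2) ℝ := !![1, 0; 0, -1]

/-- The vertex `v_ℓ = sec(π/2^n) (cos((2ℓ+1)π/2^n), sin((2ℓ+1)π/2^n))` of the regular `2^n`-gon. -/
noncomputable def vtx (n ℓ : ℕ) : Fin 2 → ℝ :=
  (Real.cos (Real.pi / 2 ^ n))⁻¹ •
    ![Real.cos ((2 * ℓ + 1) * Real.pi / 2 ^ n), Real.sin ((2 * ℓ + 1) * Real.pi / 2 ^ n)]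

/-- The facet midpoint `w_ℓ = (cos((2ℓ+2)π/2^n), sin((2ℓ+2)π/2^n))`. -/
noncomputable def wpt (n ℓ : ℕ) : Fin 2 → ℝ :=
  ![Real.cos ((2 * ℓ + 2) * Real.pi / 2 ^ n), Real.sin ((2 * ℓ + 2) * Real.pi / 2 ^ n)]

/-- `chainAux n b x i = R^{b_i} R_i ⋯ R^{b_1} R_1 x` (1-based indexing of `b` and `R`). -/
noncomputable def chainAux (n : ℕ) (b : Fin n → Fin 2) (x : Fin 2 → ℝ) : ℕ → Fin 2 → ℝ
  | 0 => x
  | i + 1 =>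
    if h : i < n then
      (reflM ^ ((b ⟨i, h⟩ : Fin 2) : ℕ)) *ᵥ (rotM i *ᵥ chainAux n b x i)
    else chainAux n b x i
/-- The polyhedron `P^∅_n` in the space of pairs `(y, z)` (0-based: `y i` is `y_{i+1}`). -/
def Pempty (n : ℕ) : Set ((Fin (n + 1) → ℝ) × (Fin (n + 1) → ℝ)) :=
  {p | (∀ i : Fin n,
        p.1 i.succ = Real.cos (Real.pi / 2 ^ (i : ℕ)) * p.1 i.castSucc
            + Real.sin (Real.pi / 2 ^ (i : ℕ)) * p.2 i.castSucc ∧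
        p.2 i.succ ≥ -Real.sin (Real.pi / 2 ^ (i : ℕ)) * p.1 i.castSucc
            + Real.cos (Real.pi / 2 ^ (i : ℕ)) * p.2 i.castSucc ∧
        p.2 i.succ ≥ Real.sin (Real.pi / 2 ^ (i : ℕ)) * p.1 i.castSucc
            - Real.cos (Real.pi / 2 ^ (i : ℕ)) * p.2 i.castSucc) ∧
    p.1 (Fin.last n) ≤ 1 ∧
    Real.cos (Real.pi / 2 ^ (n - 1)) * p.1 (Fin.last n)
        + Real.sin (Real.pi / 2 ^ (n - 1)) * p.2 (Fin.last n) ≤ 1}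

/-- The polyhedron `P^e_n` for an edge `e` (0-based indexing of `{1,…,n}` as `Fin n`). -/
def Pe (n : ℕ) (e : Finset (Fin n)) : Set ((Fin (n + 1) → ℝ) × (Fin (n + 1) → ℝ)) :=
  {p | (∀ i : Fin n,
        p.1 i.succ = Real.cos (Real.pi / 2 ^ (i : ℕ)) * p.1 i.castSucc
            + Real.sin (Real.pi / 2 ^ (i : ℕ)) * p.2 i.castSucc ∧
        (if i ∈ e then
          p.2 i.succ = -Real.sin (Real.pi / 2 ^ (i : ℕ)) * p.1 i.castSucc
              + Real.cos (Real.pi / 2 ^ (i : ℕ)) * p.2 i.castSucc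
        else
          p.2 i.succ ≥ -Real.sin (Real.pi / 2 ^ (i : ℕ)) * p.1 i.castSucc
              + Real.cos (Real.pi / 2 ^ (i : ℕ)) * p.2 i.castSucc ∧
          p.2 i.succ ≥ Real.sin (Real.pi / 2 ^ (i : ℕ)) * p.1 i.castSucc
              - Real.cos (Real.pi / 2 ^ (i : ℕ)) * p.2 i.castSucc)) ∧
    Real.cos (Real.pi / 2 ^ n) * p.1 (Fin.last n)
        + Real.sin (Real.pi / 2 ^ n) * p.2 (Fin.last n) ≤ Real.cos (Real.pi / 2 ^ n)}

/-- Projection of a pair `(y, z)` to the coordinates `(y_1, z_1)`. -/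
def proj2 {n : ℕ} (p : (Fin (n + 1) → ℝ) × (Fin (n + 1) → ℝ)) : Fin 2 → ℝ :=
  ![p.1 0, p.2 0]

/-- The regular `2^n`-gon `Q_{2^n}`, as the convex hull of its vertices. -/
def Qgon (n : ℕ) : Set (Fin 2 → ℝ) :=
  convexHull ℝ {x | ∃ ℓ < 2 ^ n, x = vtx n ℓ}

/-- The triangle `Δ_ℓ` spanned by `w_{ℓ-1}`, `v_ℓ` and `w_ℓ` (indices mod `2^n`). -/
def tri (n ℓ : ℕ) : Set (Fin 2 → ℝ) :=
  convexHull ℝ {wpt n (ℓ + 2 ^ n - 1), vtx n ℓ, wpt n ℓ}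


/-- The first coordinate is rotated, and unaffected by the optional reflection. -/
theorem chainAux_succ_zero {n i : ℕ} (hi : i < n) (b : Fin n → Fin 2) (x : Fin 2 → ℝ) :
    chainAux n b x (i + 1) 0 = Real.cos (Real.pi / 2 ^ i) * chainAux n b x i 0
      + Real.sin (Real.pi / 2 ^ i) * chainAux n b x i 1 := by
  obtain h | h : b ⟨i, hi⟩ = 0 ∨ b ⟨i, hi⟩ = 1 := by omega
  all_goals
    simp [chainAux, hi, h, reflM, rotM, Matrix.mulVec, dotProduct, Fin.sum_univ_two]

/-- The second coordinate is rotated and possibly changes its sign. -/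
theorem chainAux_succ_one {n i : ℕ} (hi : i < n) (b : Fin n → Fin 2) (x : Fin 2 → ℝ) :
    chainAux n b x (i + 1) 1 = -Real.sin (Real.pi / 2 ^ i) * chainAux n b x i 0
        + Real.cos (Real.pi / 2 ^ i) * chainAux n b x i 1 ∨
      chainAux n b x (i + 1) 1 = -(-Real.sin (Real.pi / 2 ^ i) * chainAux n b x i 0
        + Real.cos (Real.pi / 2 ^ i) * chainAux n b x i 1) := by
  obtain h | h : b ⟨i, hi⟩ = 0 ∨ b ⟨i, hi⟩ = 1 := by omega
  · left
    simp [chainAux, hi, h, rotM, Matrix.mulVec, dotProduct, Fin.sum_univ_two]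
  · right
    simp [chainAux, hi, h, reflM, rotM, Matrix.mulVec, dotProduct, Fin.sum_univ_two]

/-- If a chain ends at polar angle in `[0, 2π / 2 ^ n]`, then its `i`-th point has polar angle in
`[0, 2π / 2 ^ i]`. -/
theorem exists_angle_chainAux {n : ℕ} {b : Fin n → Fin 2} {x : Fin 2 → ℝ} {r : ℝ}
    (hend : ∃ θ : ℝ, 0 ≤ θ ∧ θ ≤ 2 * Real.pi / 2 ^ n ∧
      chainAux n b x n 0 = r * Real.cos θ ∧ chainAux n b x n 1 = r * Real.sin θ)
    {i : ℕ} (hi : i ≤ n) :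
    ∃ θ : ℝ, 0 ≤ θ ∧ θ ≤ 2 * Real.pi / 2 ^ i ∧
      chainAux n b x i 0 = r * Real.cos θ ∧ chainAux n b x i 1 = r * Real.sin θ := by
  induction hi using Nat.decreasingInduction with
  | self => exact hend
  | of_succ i hi ih =>
    obtain ⟨θ, h0, hθ, hc, hs⟩ := ih
    have hle : θ ≤ Real.pi / 2 ^ i := hθ.trans_eq (by rw [pow_succ]; field_simp)
    have h2 : 2 * Real.pi / 2 ^ i = Real.pi / 2 ^ i + Real.pi / 2 ^ i := by ring
    have hcs := Real.sin_sq_add_cos_sq (Real.pi / 2 ^ i)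
    rw [chainAux_succ_zero hi] at hc
    rcases chainAux_succ_one hi b x with h | h <;> rw [h] at hs
    · refine ⟨Real.pi / 2 ^ i + θ, by linarith, by linarith, ?_, ?_⟩
      · rw [Real.cos_add]
        linear_combination Real.cos (Real.pi / 2 ^ i) * hc - Real.sin (Real.pi / 2 ^ i) * hs
          - chainAux n b x i 0 * hcs
      · rw [Real.sin_add]
        linear_combination Real.sin (Real.pi / 2 ^ i) * hc + Real.cos (Real.pi / 2 ^ i) * hs
          - chainAux n b x i 1 * hcs
    · refine ⟨Real.pi / 2 ^ i - θ, by linarith, by linarith, ?_, ?_⟩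
      · rw [Real.cos_sub]
        linear_combination Real.cos (Real.pi / 2 ^ i) * hc + Real.sin (Real.pi / 2 ^ i) * hs
          - chainAux n b x i 0 * hcs
      · rw [Real.sin_sub]
        linear_combination Real.sin (Real.pi / 2 ^ i) * hc - Real.cos (Real.pi / 2 ^ i) * hs
          - chainAux n b x i 1 * hcs

theorem cos_pi_div_two_pow_pos {n : ℕ} (hn : 2 ≤ n) : 0 < Real.cos (Real.pi / 2 ^ n) := by
  have hpi := Real.pi_pos
  refine Real.cos_pos_of_mem_Ioo ⟨by linarith [show 0 < Real.pi / 2 ^ n by positivity], ?_⟩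
  have h : (2 : ℝ) < 2 ^ n := by
    simpa using pow_lt_pow_right₀ (one_lt_two : (1 : ℝ) < 2) (show 1 < n by omega)
  gcongr

theorem vtx_zero_zero (n : ℕ) :
    vtx n 0 0 = (Real.cos (Real.pi / 2 ^ n))⁻¹ * Real.cos (Real.pi / 2 ^ n) := by
  simp [vtx]

theorem vtx_zero_one (n : ℕ) :
    vtx n 0 1 = (Real.cos (Real.pi / 2 ^ n))⁻¹ * Real.sin (Real.pi / 2 ^ n) := by
  simp [vtx]

/-- The points of a chain ending at `v_0` lie in the upper half plane after the first step. -/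
theorem chainAux_one_nonneg {n : ℕ} (hn : 2 ≤ n) {b : Fin n → Fin 2} {x : Fin 2 → ℝ}
    (hb : chainAux n b x n = vtx n 0) {i : ℕ} (hi : i < n) :
    0 ≤ chainAux n b x (i + 1) 1 := by
  have hpi := Real.pi_pos
  obtain ⟨θ, h0, hθ, -, hs⟩ := exists_angle_chainAux (n := n) (b := b) (x := x)
    (r := (Real.cos (Real.pi / 2 ^ n))⁻¹)
    ⟨Real.pi / 2 ^ n, by positivity, by gcongr; linarith,
      by rw [hb, vtx_zero_zero], by rw [hb, vtx_zero_one]⟩ (Nat.succ_le_of_lt hi)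
  rw [hs]
  refine mul_nonneg (inv_nonneg.2 (cos_pi_div_two_pow_pos hn).le)
    (Real.sin_nonneg_of_nonneg_of_le_pi h0 (hθ.trans ?_))
  rw [div_le_iff₀ (by positivity), mul_comm]
  gcongr
  exact le_self_pow₀ one_le_two (Nat.succ_ne_zero i)

/-- Each vertex `v_ℓ` lies in the projection of `P^∅_n` onto `(y_1, z_1)`; concretely, the
point defined by `(y_1,z_1) = v_ℓ` and `(y_{i+1},z_{i+1}) = R^{b^ℓ_i} R_i (y_i,z_i)` lies in
`P^∅_n` and satisfies `(y_{n+1}, z_{n+1}) = v_0`. -/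
theorem vtx_mem_proj_Pempty (n : ℕ) (hn : 2 ≤ n) (ℓ : ℕ) (hℓ : ℓ < 2 ^ n)
    (b : Fin n → Fin 2) (hb : chainAux n b (vtx n ℓ) n = vtx n 0) :
    ((fun i : Fin (n + 1) => chainAux n b (vtx n ℓ) i 0,
      fun i : Fin (n + 1) => chainAux n b (vtx n ℓ) i 1) ∈ Pempty n) ∧
    ((fun i : Fin (n + 1) => chainAux n b (vtx n ℓ) i 0) (Fin.last n) = vtx n 0 0 ∧
      (fun i : Fin (n + 1) => chainAux n b (vtx n ℓ) i 1) (Fin.last n) = vtx n 0 1) ∧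
    vtx n ℓ ∈ proj2 '' Pempty n := by
  have hcos := cos_pi_div_two_pow_pos hn
  have h0 : vtx n 0 0 = 1 := by rw [vtx_zero_zero, inv_mul_cancel₀ hcos.ne']
  have hmem : ((fun i : Fin (n + 1) => chainAux n b (vtx n ℓ) i 0,
      fun i : Fin (n + 1) => chainAux n b (vtx n ℓ) i 1) ∈ Pempty n) := by
    refine ⟨fun i => ?_, ?_, ?_⟩
    · have hz := chainAux_one_nonneg hn hb i.isLt
      refine ⟨by simpa using chainAux_succ_zero i.isLt b (vtx n ℓ), ?_⟩
      simp only [Fin.val_succ, Fin.val_castSucc]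
      rcases chainAux_succ_one i.isLt b (vtx n ℓ) with h | h <;> constructor <;> linarith
    · simp [hb, h0]
    · simp only [Fin.val_last, hb, h0, vtx_zero_one]
      have hangle : Real.pi / 2 ^ (n - 1) = 2 * (Real.pi / 2 ^ n) := by
        obtain ⟨m, rfl⟩ : ∃ m, n = m + 1 := ⟨n - 1, by omega⟩
        rw [Nat.add_sub_cancel, pow_succ]
        field_simp
      rw [hangle, Real.cos_two_mul, Real.sin_two_mul]
      refine le_of_eq ?_
      field_simp
      linear_combination 2 * Real.sin_sq_add_cos_sq (Real.pi / 2 ^ n)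
  refine ⟨hmem, ⟨by simp [hb], by simp [hb]⟩, _, hmem, ?_⟩
  ext j
  fin_cases j <;> simp [proj2, chainAux]
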